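/- A set L ⊆ Π satisfies the Consistency property of a league if and only if for every set T ⊆ Π tolerated by L, every two processes p, p' ∈ L \ T, and every two quorums Q ∈ 𝒬(p, V*_T) and Q' ∈ 𝒬(p', V*_T) in the worst-case view with respect to T, it holds that (Q ∩ Q') \ T ≠ ∅. -/

import Mathlib

/-- A configuration: a trusted set `P` together with a collection `F` of fail-prone sets. -/
structure Config (Proc : Type) where
  P : Set Proc
  F : Set (Set Proc)

/-- `𝓕` is a fail-prone system: none of its fail-prone sets contains another. -/
def IsFPS {Proc : Type} (c : Config Proc) : Prop :=
  ∀ F ∈ c.F, ∀ F' ∈ c.F, F' ⊆ F → F' = F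

/-- A permissionless fail-prone system: a configuration for each process. -/
abbrev PFPS (Proc : Type) := Proc → Config Proc

/-- A slice of `p` (per `𝔽`) is a set of the form `P_p \ F` for some `F ∈ 𝓕_p`. -/
def IsSlice {Proc : Type} (𝔽 : PFPS Proc) (p : Proc) (S : Set Proc) : Prop :=
  ∃ F ∈ (𝔽 p).F, S = (𝔽 p).P \ F

/-- `p` has a slice in `S`: some slice of `p` is contained in `S`. -/
def HasSliceIn {Proc : Type} (𝔽 : PFPS Proc) (p : Proc) (S : Set Proc) : Prop :=
  ∃ sl, IsSlice 𝔽 p sl ∧ sl ⊆ S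

/-- The assumptions of `p` are satisfied w.r.t. the faulty set `A`: greatest
(coinductive) predicate `Sat` with `Sat p ↔ ∃ F ∈ 𝓕_p, A ∩ P_p ⊆ F ∧ ∀ q ∈ P_p \ F, Sat q`,
given here by the union of all post-fixed points. -/
def Sat {Proc : Type} (𝔽 : PFPS Proc) (A : Set Proc) (p : Proc) : Prop :=
  ∃ S : Set Proc,
    (∀ q ∈ S, ∃ F ∈ (𝔽 q).F, A ∩ (𝔽 q).P ⊆ F ∧ ∀ r ∈ (𝔽 q).P \ F, r ∈ S) ∧ p ∈ S

/-- `L` tolerates the faulty set `A`. -/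
def Tolerates {Proc : Type} (𝔽 : PFPS Proc) (L A : Set Proc) : Prop :=
  ∀ p ∈ L \ A, Sat 𝔽 A p

/-- A survivor set of `p`: `p` has a slice in `S` and every member of `S` has a slice in `S`. -/
def IsSurvivorSet {Proc : Type} (𝔽 : PFPS Proc) (p : Proc) (S : Set Proc) : Prop :=
  HasSliceIn 𝔽 p S ∧ ∀ q ∈ S, HasSliceIn 𝔽 q S

/-- A view assigns to each process either `⊥` (`none`) or a configuration. -/
abbrev View (Proc : Type) := Proc → Option (Config Proc)

/-- The PFPS `𝔽` itself, seen as the view with no `⊥` entries. -/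
def fullView {Proc : Type} (𝔽 : PFPS Proc) : View Proc := fun q => some (𝔽 q)

/-- `Q` is a quorum for `p` in view `V`: some slice of `p` (per `𝔽`) is contained in `Q`,
and every `q ∈ Q` has a non-`⊥` entry `(P_q, 𝓕_q)` in `V` with some `F ∈ 𝓕_q`
such that `P_q \ F ⊆ Q`. -/
def IsQuorum {Proc : Type} (𝔽 : PFPS Proc) (p : Proc) (V : View Proc) (Q : Set Proc) : Prop :=
  HasSliceIn 𝔽 p Q ∧
  ∀ q ∈ Q, ∃ c, V q = some c ∧ ∃ F ∈ c.F, c.P \ F ⊆ Q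

/-- A view is `T`-resilient: every process outside `T` is mapped to `⊥` or to its true
configuration. -/
def Resilient {Proc : Type} (𝔽 : PFPS Proc) (T : Set Proc) (V : View Proc) : Prop :=
  ∀ q ∉ T, V q = none ∨ V q = some (𝔽 q)

open Classical in
/-- The worst-case view w.r.t. `T`. -/
noncomputable def worstView {Proc : Type} (𝔽 : PFPS Proc) (T : Set Proc) : View Proc :=
  fun q => if q ∈ T then some ⟨∅, {∅}⟩ else some (𝔽 q)

/-- Consistency property of a league. -/
def LeagueConsistency {Proc : Type} (𝔽 : PFPS Proc) (L : Set Proc) : Prop :=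
  ∀ T : Set Proc, Tolerates 𝔽 L T →
    ∀ V V' : View Proc, Resilient 𝔽 T V → Resilient 𝔽 T V' →
      ∀ p ∈ L \ T, ∀ p' ∈ L \ T,
        ∀ Q, IsQuorum 𝔽 p V Q → ∀ Q', IsQuorum 𝔽 p' V' Q' →
          ((Q ∩ Q') \ T).Nonempty

/-- Availability property of a league. -/
def LeagueAvailability {Proc : Type} (𝔽 : PFPS Proc) (L : Set Proc) : Prop :=
  ∀ T : Set Proc, Tolerates 𝔽 L T →
    ∀ p ∈ L \ T, ∃ Q, IsQuorum 𝔽 p (fullView 𝔽) Q ∧ Q ⊆ L \ T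

/-- `L` is a league. -/
def IsLeague {Proc : Type} (𝔽 : PFPS Proc) (L : Set Proc) : Prop :=
  LeagueConsistency 𝔽 L ∧ LeagueAvailability 𝔽 L

theorem resilient_worstView {Proc : Type} (𝔽 : PFPS Proc) (T : Set Proc) :
    Resilient 𝔽 T (worstView 𝔽 T) :=
  fun _ hq => Or.inr (if_neg hq)

/-- A quorum in a `T`-resilient view is also a quorum in the worst-case view. -/
theorem IsQuorum.worstView {Proc : Type} {𝔽 : PFPS Proc} {T : Set Proc} {V : View Proc}
    {p : Proc} {Q : Set Proc} (hQ : IsQuorum 𝔽 p V Q) (hV : Resilient 𝔽 T V) :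
    IsQuorum 𝔽 p (worstView 𝔽 T) Q := by
  refine ⟨hQ.1, fun q hq => ?_⟩
  by_cases hqT : q ∈ T
  · exact ⟨⟨∅, {∅}⟩, if_pos hqT, ∅, rfl, by simp⟩
  · obtain ⟨c, hc, hF⟩ := hQ.2 q hq
    refine ⟨c, ?_, hF⟩
    rcases hV q hqT with h | h
    · simp [h] at hc
    · exact (if_neg hqT).trans (h.symm.trans hc)

/-- the Consistency property of a league holds iff it holds for quorums
taken in the worst-case views. -/
theorem consistency_iff_worst_case
    {Proc : Type} (𝔽 : PFPS Proc) (h𝔽 : ∀ p, IsFPS (𝔽 p)) (L : Set Proc) :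
    LeagueConsistency 𝔽 L ↔
      ∀ T : Set Proc, Tolerates 𝔽 L T →
        ∀ p ∈ L \ T, ∀ p' ∈ L \ T,
          ∀ Q, IsQuorum 𝔽 p (worstView 𝔽 T) Q →
            ∀ Q', IsQuorum 𝔽 p' (worstView 𝔽 T) Q' →
              ((Q ∩ Q') \ T).Nonempty := by
  constructor
  · intro h T hT p hp p' hp' Q hQ Q' hQ'
    exact h T hT _ _ (resilient_worstView 𝔽 T) (resilient_worstView 𝔽 T) p hp p' hp' Q hQ Q' hQ'
  · intro h T hT V V' hV hV' p hp p' hp' Q hQ Q' hQ'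
    exact h T hT p hp p' hp' Q (hQ.worstView hV) Q' (hQ'.worstView hV')
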